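/- Let S and R be real Hilbert spaces and T : S → R a compact linear operator with adjoint T* : R → S. Assume (φ_j)_{j≥1} is a Hilbert (orthonormal) basis of S consisting of eigenvectors of T*T with eigenvalues λ₁ ≥ λ₂ ≥ … ≥ 0 in nonincreasing order, i.e. T*T φ_j = λ_j φ_j for all j. Then for every n ≥ 0 the Kolmogorov n-width d_n(T(S); R) := inf over subspaces Rⁿ ⊆ R with dim Rⁿ ≤ n of sup_{ψ ∈ S, ψ≠0} inf_{ζ ∈ Rⁿ} ‖Tψ − ζ‖_R / ‖ψ‖_S satisfies d_n(T(S); R) = √λ_{n+1}, and the subspace Rⁿ = span{ Tφ₁, …, Tφ_n } attains this infimum. -/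

import Mathlib

noncomputable section

section TransferWidth

variable {S R : Type*}
  [NormedAddCommGroup S] [InnerProductSpace ℝ S]
  [NormedAddCommGroup R] [InnerProductSpace ℝ R]

lemma iInf_norm_sub_nonneg (V : Submodule ℝ R) (x : R) : 0 ≤ ⨅ z : V, ‖x - z.1‖ :=
  Real.iInf_nonneg fun _ => norm_nonneg _

lemma iInf_norm_sub_le (V : Submodule ℝ R) (x : R) (z : V) :
    ⨅ z : V, ‖x - z.1‖ ≤ ‖x - z.1‖ :=
  ciInf_le (f := fun z : V => ‖x - z.1‖) ⟨0, by rintro _ ⟨w, rfl⟩; exact norm_nonneg _⟩ z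

lemma bddAbove_range_iInf_norm_sub_div (T : S →L[ℝ] R) (V : Submodule ℝ R) :
    BddAbove (Set.range fun ψ : {ψ : S // ψ ≠ 0} => (⨅ z : V, ‖T ψ.1 - z.1‖) / ‖ψ.1‖) := by
  refine ⟨‖T‖, ?_⟩
  rintro _ ⟨ψ, rfl⟩
  have hψ : 0 < ‖ψ.1‖ := norm_pos_iff.2 ψ.2
  refine (div_le_iff₀ hψ).2 ((iInf_norm_sub_le V (T ψ.1) 0).trans ?_)
  simpa using T.le_opNorm ψ.1

lemma exists_ne_zero_mem_span_orthogonal (T : S →L[ℝ] R) {φ : ℕ → S}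
    (hφ : LinearIndependent ℝ φ) {n : ℕ} (V : Submodule ℝ R) (hV : Module.rank ℝ V ≤ n) :
    ∃ ψ ∈ Submodule.span ℝ (Set.range fun i : Fin (n + 1) => φ i),
      ψ ≠ 0 ∧ ∀ z ∈ V, inner ℝ z (T ψ) = 0 := by
  have : FiniteDimensional ℝ V :=
    Module.rank_lt_aleph0_iff.1 (hV.trans_lt Cardinal.natCast_lt_aleph0)
  have hfin : Module.finrank ℝ V < Module.finrank ℝ (Fin (n + 1) → ℝ) := by
    rw [Module.finrank_fin_fun]
    exact Nat.lt_succ_of_le (Module.finrank_le_of_rank_le hV)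
  have hker := LinearMap.ker_ne_bot_of_finrank_lt (f := V.orthogonalProjectionOnto.toLinearMap ∘ₗ
    T.toLinearMap ∘ₗ Fintype.linearCombination ℝ fun i : Fin (n + 1) => φ i) hfin
  obtain ⟨c, hc, hc0⟩ := Submodule.exists_mem_ne_zero_of_ne_bot hker
  refine ⟨Fintype.linearCombination ℝ (fun i : Fin (n + 1) => φ i) c, ?_, fun h => hc0 ?_, ?_⟩
  · rw [← Fintype.range_linearCombination]
    exact LinearMap.mem_range_self _ c
  · have hinj := (hφ.comp (fun i : Fin (n + 1) => (i : ℕ)) Fin.val_injective)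
    exact hinj.fintypeLinearCombination_injective (h.trans (map_zero _).symm)
  · exact (Submodule.mem_orthogonal V _).1
      (Submodule.orthogonalProjectionOnto_eq_zero_iff.1 (LinearMap.mem_ker.1 hc))

variable [CompleteSpace S]

lemma hasSum_inner_mul_inner_of_orthonormal {φ : ℕ → S} (horth : Orthonormal ℝ φ)
    (hbasis : (Submodule.span ℝ (Set.range φ)).topologicalClosure = ⊤) (x y : S) :
    HasSum (fun j => inner ℝ x (φ j) * inner ℝ (φ j) y) (inner ℝ x y) := by
  simpa using (HilbertBasis.mk horth hbasis.ge).hasSum_inner_mul_inner x y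

variable [CompleteSpace R]

lemma hasSum_norm_sq_apply (T : S →L[ℝ] R) {φ : ℕ → S} {lam : ℕ → ℝ} (horth : Orthonormal ℝ φ)
    (hbasis : (Submodule.span ℝ (Set.range φ)).topologicalClosure = ⊤)
    (heig : ∀ j, (ContinuousLinearMap.adjoint T) (T (φ j)) = lam j • φ j) (x : S) :
    HasSum (fun j => lam j * (inner ℝ (φ j) x) ^ 2) (‖T x‖ ^ 2) := by
  have h := hasSum_inner_mul_inner_of_orthonormal horth hbasis ((ContinuousLinearMap.adjoint T) (T x)) x
  rw [ContinuousLinearMap.adjoint_inner_left, real_inner_self_eq_norm_sq] at h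
  convert h using 2 with j
  rw [ContinuousLinearMap.adjoint_inner_left, ← ContinuousLinearMap.adjoint_inner_right, heig,
    real_inner_smul_right, real_inner_comm]
  ring

lemma hasSum_norm_sq {φ : ℕ → S} (horth : Orthonormal ℝ φ)
    (hbasis : (Submodule.span ℝ (Set.range φ)).topologicalClosure = ⊤) (x : S) :
    HasSum (fun j => (inner ℝ (φ j) x) ^ 2) (‖x‖ ^ 2) := by
  have h := hasSum_inner_mul_inner_of_orthonormal horth hbasis x x
  rw [real_inner_self_eq_norm_sq] at h
  convert h using 2 with j
  rw [real_inner_comm, sq]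

lemma norm_apply_le_of_orthogonal (T : S →L[ℝ] R) {φ : ℕ → S} {lam : ℕ → ℝ}
    (horth : Orthonormal ℝ φ)
    (hbasis : (Submodule.span ℝ (Set.range φ)).topologicalClosure = ⊤)
    (hanti : Antitone lam)
    (heig : ∀ j, (ContinuousLinearMap.adjoint T) (T (φ j)) = lam j • φ j) {n : ℕ} {x : S}
    (hx : ∀ j < n, inner ℝ (φ j) x = 0) : ‖T x‖ ≤ √(lam n) * ‖x‖ := by
  have h : ‖T x‖ ^ 2 ≤ lam n * ‖x‖ ^ 2 := by
    refine hasSum_le (fun j => ?_) (hasSum_norm_sq_apply T horth hbasis heig x)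
      ((hasSum_norm_sq horth hbasis x).mul_left (lam n))
    rcases lt_or_ge j n with hj | hj
    · simp [hx j hj]
    · exact mul_le_mul_of_nonneg_right (hanti hj) (sq_nonneg _)
  calc ‖T x‖ = √(‖T x‖ ^ 2) := (Real.sqrt_sq (norm_nonneg _)).symm
    _ ≤ √(lam n * ‖x‖ ^ 2) := Real.sqrt_le_sqrt h
    _ = √(lam n) * ‖x‖ := by rw [Real.sqrt_mul' _ (sq_nonneg _), Real.sqrt_sq (norm_nonneg _)]

lemma le_norm_apply_of_mem_span (T : S →L[ℝ] R) {φ : ℕ → S} {lam : ℕ → ℝ}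
    (horth : Orthonormal ℝ φ)
    (hbasis : (Submodule.span ℝ (Set.range φ)).topologicalClosure = ⊤)
    (hanti : Antitone lam)
    (heig : ∀ j, (ContinuousLinearMap.adjoint T) (T (φ j)) = lam j • φ j) {n : ℕ} {x : S}
    (hx : x ∈ Submodule.span ℝ (Set.range fun i : Fin (n + 1) => φ i)) :
    √(lam n) * ‖x‖ ≤ ‖T x‖ := by
  have h : lam n * ‖x‖ ^ 2 ≤ ‖T x‖ ^ 2 := by
    refine hasSum_le (fun j => ?_) ((hasSum_norm_sq horth hbasis x).mul_left (lam n))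
      (hasSum_norm_sq_apply T horth hbasis heig x)
    rcases le_or_gt j n with hj | hj
    · exact mul_le_mul_of_nonneg_right (hanti hj) (sq_nonneg _)
    · have hzero : inner ℝ (φ j) x = 0 := by
        induction hx using Submodule.span_induction with
        | mem y hy =>
          obtain ⟨i, rfl⟩ := hy
          exact horth.2 (by omega)
        | zero => exact inner_zero_right _
        | add y z _ _ hy hz => rw [inner_add_right, hy, hz, add_zero]
        | smul a y _ hy => rw [real_inner_smul_right, hy, mul_zero]
      simp [hzero]
  calc √(lam n) * ‖x‖ = √(lam n * ‖x‖ ^ 2) := by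
        rw [Real.sqrt_mul' _ (sq_nonneg _), Real.sqrt_sq (norm_nonneg _)]
    _ ≤ √(‖T x‖ ^ 2) := Real.sqrt_le_sqrt h
    _ = ‖T x‖ := Real.sqrt_sq (norm_nonneg _)

lemma iSup_iInf_span_le (T : S →L[ℝ] R) {φ : ℕ → S} {lam : ℕ → ℝ}
    (horth : Orthonormal ℝ φ)
    (hbasis : (Submodule.span ℝ (Set.range φ)).topologicalClosure = ⊤)
    (hanti : Antitone lam)
    (heig : ∀ j, (ContinuousLinearMap.adjoint T) (T (φ j)) = lam j • φ j) (n : ℕ) :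
    (⨆ ψ : {ψ : S // ψ ≠ 0},
        (⨅ z : (Submodule.span ℝ (Set.range fun i : Fin n => T (φ i))),
          ‖T ψ.1 - z.1‖) / ‖ψ.1‖) ≤ √(lam n) := by
  refine Real.iSup_le (fun ψ => ?_) (Real.sqrt_nonneg _)
  refine (div_le_iff₀ (norm_pos_iff.2 ψ.2)).2 ?_
  set p : S := ∑ i : Fin n, inner ℝ (φ i) ψ.1 • φ i with hp
  have hTp : T p ∈ Submodule.span ℝ (Set.range fun i : Fin n => T (φ i)) := by
    rw [hp, map_sum]
    refine Submodule.sum_mem _ fun i _ => ?_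
    rw [map_smul]
    exact Submodule.smul_mem _ _ (Submodule.subset_span ⟨i, rfl⟩)
  have horthn : Orthonormal ℝ fun i : Fin n => φ i := horth.comp _ Fin.val_injective
  have hinner : ∀ i : Fin n, inner ℝ (φ i) (ψ.1 - p) = 0 := fun i => by
    rw [inner_sub_right, hp, horthn.inner_right_fintype, sub_self]
  have hpinner : inner ℝ p (ψ.1 - p) = 0 := by
    conv_lhs => rw [hp, sum_inner]
    exact Finset.sum_eq_zero fun i _ => by
      rw [real_inner_smul_left, ← hp, hinner, mul_zero]
  have hnorm : ‖ψ.1 - p‖ ≤ ‖ψ.1‖ := by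
    have h := norm_add_sq_eq_norm_sq_add_norm_sq_real hpinner
    rw [add_sub_cancel] at h
    nlinarith [norm_nonneg p, norm_nonneg ψ.1, norm_nonneg (ψ.1 - p)]
  calc _ ≤ ‖T ψ.1 - T p‖ := iInf_norm_sub_le _ _ ⟨T p, hTp⟩
    _ = ‖T (ψ.1 - p)‖ := by rw [map_sub]
    _ ≤ √(lam n) * ‖ψ.1 - p‖ :=
      norm_apply_le_of_orthogonal T horth hbasis hanti heig fun j hj => hinner ⟨j, hj⟩
    _ ≤ √(lam n) * ‖ψ.1‖ := mul_le_mul_of_nonneg_left hnorm (Real.sqrt_nonneg _)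

lemma sqrt_le_iSup_iInf_of_rank_le (T : S →L[ℝ] R) {φ : ℕ → S} {lam : ℕ → ℝ}
    (horth : Orthonormal ℝ φ)
    (hbasis : (Submodule.span ℝ (Set.range φ)).topologicalClosure = ⊤)
    (hanti : Antitone lam)
    (heig : ∀ j, (ContinuousLinearMap.adjoint T) (T (φ j)) = lam j • φ j) {n : ℕ}
    (V : Submodule ℝ R) (hV : Module.rank ℝ V ≤ n) :
    √(lam n) ≤ ⨆ ψ : {ψ : S // ψ ≠ 0}, (⨅ z : V, ‖T ψ.1 - z.1‖) / ‖ψ.1‖ := by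
  obtain ⟨ψ, hψ, hψ0, hperp⟩ :=
    exists_ne_zero_mem_span_orthogonal T horth.linearIndependent V hV
  refine le_trans ?_ (le_ciSup (bddAbove_range_iInf_norm_sub_div T V) ⟨ψ, hψ0⟩)
  refine (le_div_iff₀ (norm_pos_iff.2 hψ0)).2 (le_ciInf fun z => ?_)
  refine (le_norm_apply_of_mem_span T horth hbasis hanti heig hψ).trans ?_
  have hz : inner ℝ (T ψ) z.1 = 0 := by rw [real_inner_comm]; exact hperp z.1 z.2
  refine abs_le_of_sq_le_sq' ?_ (norm_nonneg _) |>.2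
  rw [sq, sq, norm_sub_sq_eq_norm_sq_add_norm_sq_real hz]
  exact le_add_of_nonneg_right (mul_self_nonneg _)

end TransferWidth

theorem stmt13 (S R : Type*)
    [NormedAddCommGroup S] [InnerProductSpace ℝ S] [CompleteSpace S]
    [NormedAddCommGroup R] [InnerProductSpace ℝ R] [CompleteSpace R]
    (T : S →L[ℝ] R) (hT : IsCompactOperator T)
    (φ : ℕ → S) (lam : ℕ → ℝ)
    (horth : Orthonormal ℝ φ)
    (hbasis : (Submodule.span ℝ (Set.range φ)).topologicalClosure = ⊤)
    (hanti : Antitone lam) (hnonneg : ∀ j, 0 ≤ lam j)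
    (heig : ∀ j, (ContinuousLinearMap.adjoint T) (T (φ j)) = lam j • φ j)
    (n : ℕ) :
    (⨅ V : {V : Submodule ℝ R // Module.rank ℝ V ≤ n},
        ⨆ ψ : {ψ : S // ψ ≠ 0}, (⨅ z : V.1, ‖T ψ.1 - z.1‖) / ‖ψ.1‖)
      = Real.sqrt (lam n)
    ∧ (⨆ ψ : {ψ : S // ψ ≠ 0},
        (⨅ z : (Submodule.span ℝ (Set.range fun i : Fin n => T (φ i))),
          ‖T ψ.1 - z.1‖) / ‖ψ.1‖)
      = Real.sqrt (lam n) := by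
  have hrank : Module.rank ℝ (Submodule.span ℝ (Set.range fun i : Fin n => T (φ i))) ≤ n := by
    refine (rank_span_le _).trans ?_
    simpa using Cardinal.mk_range_le_lift (f := fun i : Fin n => T (φ i))
  have hle := iSup_iInf_span_le T horth hbasis hanti heig n
  have : Nonempty {V : Submodule ℝ R // Module.rank ℝ V ≤ n} := ⟨⟨_, hrank⟩⟩
  have hbdd : BddBelow (Set.range fun V : {V : Submodule ℝ R // Module.rank ℝ V ≤ n} =>
      ⨆ ψ : {ψ : S // ψ ≠ 0}, (⨅ z : V.1, ‖T ψ.1 - z.1‖) / ‖ψ.1‖) := by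
    refine ⟨0, ?_⟩
    rintro _ ⟨V, rfl⟩
    exact Real.iSup_nonneg fun ψ => div_nonneg (iInf_norm_sub_nonneg _ _) (norm_nonneg _)
  constructor
  · refine le_antisymm ((ciInf_le hbdd ⟨_, hrank⟩).trans hle) ?_
    exact le_ciInf fun V => sqrt_le_iSup_iInf_of_rank_le T horth hbasis hanti heig V.1 V.2
  · exact hle.antisymm (sqrt_le_iSup_iInf_of_rank_le T horth hbasis hanti heig _ hrank)

end
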